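/- Let x₁,…,x_i be independent standard Gaussian random vectors in ℝ^d with 1 ≤ i ≤ d. There is a constant C depending only on d and i such that for all κ ≥ 1, E(‖x₁ ∧ ⋯ ∧ x_i‖^{-(d-i+1)} · 𝟙(‖x₁ ∧ ⋯ ∧ x_i‖ > e^{-κ})) ≤ C κ. -/

import Mathlib

open MeasureTheory ProbabilityTheory

/-- The standard Gaussian measure on `ℝ^d` (i.i.d. `N(0,1)` coordinates). -/
noncomputable def stdGaussian (d : ℕ) : Measure (Fin d → ℝ) :=
  Measure.pi fun _ => gaussianReal 0 1

/-- The norm of the wedge product `x₁ ∧ ⋯ ∧ x_i` in `⋀^i ℝ^d`, computed as the square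
root of the Gram determinant. -/
noncomputable def wedgeNorm {d : ℕ} {i : ℕ} (x : Fin i → (Fin d → ℝ)) : ℝ :=
  Real.sqrt (Matrix.det (Matrix.of fun a b : Fin i => ∑ j, x a j * x b j))

open scoped ENNReal RealInnerProductSpace

theorem MeasureTheory.Measure.pi_le_pi {ι : Type*} [Fintype ι] {α : ι → Type*}
    [∀ i, MeasurableSpace (α i)] {μ ν : ∀ i, Measure (α i)} (h : ∀ i, μ i ≤ ν i) :
    Measure.pi μ ≤ Measure.pi ν := by
  refine Measure.le_iff.2 fun s hs => ?_
  rw [Measure.pi, Measure.pi, toMeasure_apply _ _ hs, toMeasure_apply _ _ hs]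
  exact OuterMeasure.le_pi.2 (fun t _ => (OuterMeasure.pi_pi_le _ t).trans
    (Finset.prod_le_prod' fun i _ => h i (t i))) s

theorem gaussianReal_zero_one_le_volume : gaussianReal 0 1 ≤ (volume : Measure ℝ) := by
  rw [gaussianReal_of_var_ne_zero _ one_ne_zero]
  calc volume.withDensity (gaussianPDF 0 1) ≤ volume.withDensity 1 := by
        refine withDensity_mono (Filter.Eventually.of_forall fun x => ?_)
        rw [gaussianPDF, Pi.one_apply, ENNReal.ofReal_le_one, gaussianPDFReal]
        refine mul_le_one₀ (inv_le_one_of_one_le₀ ?_) (Real.exp_nonneg _) ?_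
        · rw [Real.one_le_sqrt, NNReal.coe_one]
          linarith [Real.pi_gt_three]
        · rw [Real.exp_le_one_iff, NNReal.coe_one]
          linarith [sq_nonneg (x - 0)]
    _ = volume := withDensity_one

theorem stdGaussian_euclideanSpace_le_volume (ι : Type*) [Fintype ι] :
    ProbabilityTheory.stdGaussian (EuclideanSpace ℝ ι) ≤ volume := by
  rw [← map_pi_eq_stdGaussian, ← (PiLp.volume_preserving_toLp ι).map_eq, volume_pi]
  exact Measure.map_mono (Measure.pi_le_pi fun _ => gaussianReal_zero_one_le_volume)
    (PiLp.volume_preserving_toLp ι).measurable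

/-- The negative moments of the norm on the unit ball, in polar coordinates. -/
theorem setLIntegral_ball_norm_rpow_neg {E : Type*} [NormedAddCommGroup E] [NormedSpace ℝ E]
    [FiniteDimensional ℝ E] [MeasurableSpace E] [BorelSpace E] [Nontrivial E] (μ : Measure E)
    [μ.IsAddHaarMeasure] {s : ℝ} (hs : s < Module.finrank ℝ E) :
    ∫⁻ x in Metric.ball 0 1, ENNReal.ofReal (‖x‖ ^ (-s)) ∂μ
      = ENNReal.ofReal (Module.finrank ℝ E * μ.real (Metric.ball 0 1)
          / (Module.finrank ℝ E - s)) := by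
  set n := Module.finrank ℝ E with hn
  have hpos : 0 < n := Module.finrank_pos
  have key : ∀ y : ℝ, 0 < y → y ^ (n - 1) • y ^ (-s) = y ^ ((n : ℝ) - 1 - s) := by
    intro y hy
    rw [smul_eq_mul, ← Real.rpow_natCast, ← Real.rpow_add hy, Nat.cast_pred hpos]
    ring_nf
  have hexp : -1 < (n : ℝ) - 1 - s := by linarith
  have hint : IntegrableOn (fun x : E => ‖x‖ ^ (-s)) (Metric.ball 0 1) μ := by
    rw [integrableOn_fun_norm_addHaar μ (f := fun y : ℝ => y ^ (-s)), ← hn,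
      integrableOn_congr_fun (fun y hy => key y hy.1) measurableSet_Ioo]
    exact (intervalIntegral.integrableOn_Ioo_rpow_iff one_pos).2 hexp
  rw [← ofReal_integral_eq_lintegral_ofReal hint
    (Filter.Eventually.of_forall fun x => Real.rpow_nonneg (norm_nonneg x) _)]
  congr 1
  have hball : (fun x : E => (Metric.ball (0 : E) 1).indicator (fun x : E => ‖x‖ ^ (-s)) x)
      = fun x : E => (Set.Iio (1 : ℝ)).indicator (fun y => y ^ (-s)) ‖x‖ := by
    ext x
    simp [Set.indicator]
  rw [← integral_indicator measurableSet_ball, hball, integral_fun_norm_addHaar, ← hn]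
  have hradial : ∫ y in Set.Ioi (0 : ℝ),
      y ^ (n - 1) • (Set.Iio (1 : ℝ)).indicator (fun y => y ^ (-s)) y = 1 / (n - s) := by
    calc _ = ∫ y in Set.Ioi (0 : ℝ),
          (Set.Iio (1 : ℝ)).indicator (fun y => y ^ ((n : ℝ) - 1 - s)) y := by
          refine setIntegral_congr_fun measurableSet_Ioi fun y hy => ?_
          by_cases h : y < 1
          · simpa [h] using key y hy
          · simp [h]
      _ = ∫ y in (0 : ℝ)..1, y ^ ((n : ℝ) - 1 - s) := by
          rw [setIntegral_indicator measurableSet_Iio, Set.Ioi_inter_Iio,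
            intervalIntegral.integral_of_le zero_le_one, integral_Ioc_eq_integral_Ioo]
      _ = 1 / (n - s) := by
          rw [integral_rpow (Or.inl hexp), Real.one_rpow, Real.zero_rpow (by linarith)]
          ring_nf
  rw [hradial, nsmul_eq_mul, smul_eq_mul]
  ring

theorem lintegral_norm_rpow_neg_stdGaussian_euclideanSpace_le {n : ℕ} (hn : 0 < n) {s : ℝ}
    (hs₀ : 0 ≤ s) (hs : s < n) :
    ∫⁻ x, ENNReal.ofReal (‖x‖ ^ (-s)) ∂ProbabilityTheory.stdGaussian (EuclideanSpace ℝ (Fin n))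
      ≤ ENNReal.ofReal ((n * volume.real (Metric.ball (0 : EuclideanSpace ℝ (Fin n)) 1) + n)
          / (n - s)) := by
  have : Nonempty (Fin n) := ⟨⟨0, hn⟩⟩
  set γ := ProbabilityTheory.stdGaussian (EuclideanSpace ℝ (Fin n))
  have hns : 0 < (n : ℝ) - s := by linarith
  have hball : ∫⁻ x in Metric.ball 0 1, ENNReal.ofReal (‖x‖ ^ (-s)) ∂γ
      ≤ ENNReal.ofReal (n * volume.real (Metric.ball (0 : EuclideanSpace ℝ (Fin n)) 1)
          / (n - s)) := by
    refine (lintegral_mono' (Measure.restrict_mono_measure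
      (stdGaussian_euclideanSpace_le_volume (Fin n)) _) le_rfl).trans_eq ?_
    simpa using setLIntegral_ball_norm_rpow_neg
      (volume : Measure (EuclideanSpace ℝ (Fin n))) (s := s) (by simpa using hs)
  have hcompl : ∫⁻ x in (Metric.ball 0 1)ᶜ, ENNReal.ofReal (‖x‖ ^ (-s)) ∂γ
      ≤ ENNReal.ofReal (n / (n - s)) := by
    calc _ ≤ ∫⁻ x in (Metric.ball 0 1)ᶜ, 1 ∂γ := by
          refine setLIntegral_mono measurable_const fun x hx => ?_
          rw [ENNReal.ofReal_le_one]
          exact Real.rpow_le_one_of_one_le_of_nonpos (by simpa using hx) (by linarith)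
      _ ≤ 1 := by
          rw [setLIntegral_one]
          exact prob_le_one
      _ ≤ _ := by
          rw [ENNReal.one_le_ofReal, one_le_div hns]
          linarith
  rw [← lintegral_add_compl _ measurableSet_ball, add_div, ENNReal.ofReal_add]
  · exact add_le_add hball hcompl
  all_goals positivity

theorem lintegral_norm_rpow_neg_stdGaussian_eq {E : Type*} [NormedAddCommGroup E]
    [InnerProductSpace ℝ E] [FiniteDimensional ℝ E] [MeasurableSpace E] [BorelSpace E] (s : ℝ) :
    ∫⁻ x, ENNReal.ofReal (‖x‖ ^ (-s)) ∂ProbabilityTheory.stdGaussian E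
      = ∫⁻ x, ENNReal.ofReal (‖x‖ ^ (-s))
          ∂ProbabilityTheory.stdGaussian (EuclideanSpace ℝ (Fin (Module.finrank ℝ E))) := by
  rw [← stdGaussian_map (stdOrthonormalBasis ℝ E).repr, lintegral_map (by fun_prop) (by fun_prop)]
  simp

/-- The image of a standard Gaussian under an orthogonal projection is standard Gaussian. -/
theorem stdGaussian_map_orthogonalProjectionOnto {E : Type*} [NormedAddCommGroup E]
    [InnerProductSpace ℝ E] [FiniteDimensional ℝ E] [MeasurableSpace E] [BorelSpace E]
    (U : Submodule ℝ E) :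
    (ProbabilityTheory.stdGaussian E).map U.orthogonalProjectionOnto
      = ProbabilityTheory.stdGaussian U := by
  have : IsProbabilityMeasure
      ((ProbabilityTheory.stdGaussian E).map U.orthogonalProjectionOnto) :=
    Measure.isProbabilityMeasure_map (by fun_prop)
  apply Measure.ext_of_charFun
  ext t
  rw [charFun_stdGaussian, charFun_apply, integral_map (by fun_prop) (by fun_prop)]
  simp_rw [Submodule.inner_orthogonalProjectionOnto_eq_of_mem_right]
  rw [← charFun_apply, charFun_stdGaussian, Submodule.coe_norm]

theorem exists_lintegral_norm_orthogonalProjectionOnto_rpow_neg_le (d m : ℕ) (hm : 0 < m) :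
    ∃ C : ℝ, 0 < C ∧ ∀ U : Submodule ℝ (EuclideanSpace ℝ (Fin d)), m ≤ Module.finrank ℝ U →
      ∀ s : ℝ, 0 ≤ s → s < m →
        ∫⁻ x, ENNReal.ofReal (‖U.orthogonalProjectionOnto x‖ ^ (-s))
            ∂ProbabilityTheory.stdGaussian (EuclideanSpace ℝ (Fin d))
          ≤ ENNReal.ofReal (C / (m - s)) := by
  set c : ℕ → ℝ := fun n =>
    n * volume.real (Metric.ball (0 : EuclideanSpace ℝ (Fin n)) 1) + n
  have hc : ∀ n, 0 ≤ c n := fun n => by positivity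
  refine ⟨∑ n ∈ Finset.range (d + 1), c n + 1,
    add_pos_of_nonneg_of_pos (Finset.sum_nonneg fun n _ => hc n) one_pos,
    fun U hU s hs₀ hs => ?_⟩
  have hU' : (m : ℝ) ≤ Module.finrank ℝ U := by exact_mod_cast hU
  have hUd : Module.finrank ℝ U ≤ d := by simpa using U.finrank_le
  have hle : c (Module.finrank ℝ U) ≤ ∑ n ∈ Finset.range (d + 1), c n :=
    Finset.single_le_sum (fun n _ => hc n) (Finset.mem_range.2 (by omega))
  calc _ = ∫⁻ y, ENNReal.ofReal (‖y‖ ^ (-s)) ∂ProbabilityTheory.stdGaussian U := by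
        rw [← stdGaussian_map_orthogonalProjectionOnto U,
          lintegral_map (by fun_prop) (by fun_prop)]
    _ ≤ ENNReal.ofReal (c (Module.finrank ℝ U) / (Module.finrank ℝ U - s)) := by
        rw [lintegral_norm_rpow_neg_stdGaussian_eq]
        exact lintegral_norm_rpow_neg_stdGaussian_euclideanSpace_le (hm.trans_le hU) hs₀
          (hs.trans_le hU')
    _ ≤ _ := by
        have : 0 < (m : ℝ) - s := by linarith
        refine ENNReal.ofReal_le_ofReal ?_
        gcongr
        linarith

/-- The squared norm of a wedge product is multiplicative along an orthogonal decomposition of the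
first vector. -/
theorem det_gram_fin_cons {E : Type*} [NormedAddCommGroup E] [InnerProductSpace ℝ E] [FiniteDimensional ℝ E]
    {k : ℕ} (v : E) (w : Fin k → E) :
    (Matrix.gram ℝ (Fin.cons v w : Fin (k + 1) → E)).det
      = ‖(Submodule.span ℝ (Set.range w))ᗮ.orthogonalProjectionOnto v‖ ^ 2
        * (Matrix.gram ℝ w).det := by
  set V := Submodule.span ℝ (Set.range w)
  set u : E := (Vᗮ.orthogonalProjectionOnto v : E) with hu
  have hvu : v - u ∈ V := by simp [hu]
  obtain ⟨c, hc⟩ := (Submodule.mem_span_range_iff_exists_fun ℝ).1 hvu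
  have huV : u ∈ Vᗮ := Submodule.coe_mem _
  set G := Matrix.gram ℝ (Fin.cons v w : Fin (k + 1) → E) with hG
  have hrow : G.updateRow 0 (∑ j, (Fin.cons 1 (-c) : Fin (k + 1) → ℝ) j • G j)
      = G.updateRow 0 (Fin.cons (‖u‖ ^ 2) 0) := by
    congr 1
    have hin : ∀ z, ⟪v, z⟫ - ∑ j, c j * ⟪w j, z⟫ = ⟪u, z⟫ := by
      intro z
      have : u = v - ∑ j, c j • w j := by rw [hc]; abel
      rw [this, inner_sub_left, sum_inner]
      simp_rw [real_inner_smul_left]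
    ext a
    have : (∑ j, (Fin.cons 1 (-c) : Fin (k + 1) → ℝ) j • G j) a
        = ⟪u, (Fin.cons v w : Fin (k + 1) → E) a⟫ := by
      rw [← hin, Finset.sum_apply, Fin.sum_univ_succ]
      simp [hG, Matrix.gram_apply, sub_eq_add_neg]
    rw [this]
    refine Fin.cases ?_ (fun b => ?_) a
    · have h0 : ⟪u, v - u⟫ = 0 := Submodule.inner_left_of_mem_orthogonal hvu huV
      rw [inner_sub_right, sub_eq_zero] at h0
      simp [h0]
    · simpa using Submodule.inner_left_of_mem_orthogonal
        (Submodule.subset_span (Set.mem_range_self b)) huV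
  have h := G.det_updateRow_sum 0 (Fin.cons 1 (-c) : Fin (k + 1) → ℝ)
  rw [hrow, Fin.cons_zero, one_smul] at h
  rw [← h, Matrix.det_succ_row_zero, Fin.sum_univ_succ]
  have hsub : (G.updateRow 0 (Fin.cons (‖u‖ ^ 2) 0)).submatrix Fin.succ (Fin.succAbove 0)
      = Matrix.gram ℝ w := by
    ext a b
    simp [hG, Matrix.gram_apply]
  rw [hsub]
  simp [hu]

theorem wedgeNorm_eq_sqrt_det_gram {d i : ℕ} (x : Fin i → Fin d → ℝ) :
    wedgeNorm x = √(Matrix.gram ℝ fun a => WithLp.toLp 2 (x a)).det := by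
  rw [wedgeNorm]
  congr 2
  ext a b
  simp [Matrix.gram_apply, PiLp.inner_apply, mul_comm]

theorem wedgeNorm_nonneg {d i : ℕ} (x : Fin i → Fin d → ℝ) : 0 ≤ wedgeNorm x :=
  Real.sqrt_nonneg _

theorem wedgeNorm_fin_cons {d k : ℕ} (v : Fin d → ℝ) (w : Fin k → Fin d → ℝ) :
    wedgeNorm (Fin.cons v w : Fin (k + 1) → Fin d → ℝ)
      = ‖(Submodule.span ℝ (Set.range fun a => WithLp.toLp 2 (w a)))ᗮ.orthogonalProjectionOnto
          (WithLp.toLp 2 v)‖ * wedgeNorm w := by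
  have : (fun a => WithLp.toLp 2 ((Fin.cons v w : Fin (k + 1) → Fin d → ℝ) a))
      = Fin.cons (WithLp.toLp 2 v) fun a => WithLp.toLp 2 (w a) := by
    ext a
    refine Fin.cases ?_ (fun b => ?_) a <;> simp
  rw [wedgeNorm_eq_sqrt_det_gram, this, det_gram_fin_cons, Real.sqrt_mul (sq_nonneg _),
    Real.sqrt_sq (norm_nonneg _), wedgeNorm_eq_sqrt_det_gram]

theorem measurable_wedgeNorm (d i : ℕ) :
    Measurable (wedgeNorm : (Fin i → Fin d → ℝ) → ℝ) := by
  unfold wedgeNorm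
  refine (Continuous.sqrt (Continuous.matrix_det ?_)).measurable
  exact continuous_matrix fun a b => by simp only [Matrix.of_apply]; fun_prop

instance isProbabilityMeasure_stdGaussian_pi (d : ℕ) :
    IsProbabilityMeasure (_root_.stdGaussian d) := by
  unfold _root_.stdGaussian
  infer_instance

theorem exists_lintegral_wedgeNorm_rpow_neg_le (d k : ℕ) (hk : k ≤ d) :
    ∃ C : ℝ, 0 < C ∧ ∀ s : ℝ, 0 ≤ s → s < (d : ℝ) - k + 1 →
      ∫⁻ x : Fin k → Fin d → ℝ, ENNReal.ofReal (wedgeNorm x ^ (-s))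
          ∂(Measure.pi fun _ => _root_.stdGaussian d)
        ≤ ENNReal.ofReal (C / ((d : ℝ) - k + 1 - s)) := by
  induction k with
  | zero =>
    refine ⟨d + 1, by positivity, fun s hs₀ hs => ?_⟩
    have hw : ∀ x : Fin 0 → Fin d → ℝ, wedgeNorm x = 1 := fun x => by simp [wedgeNorm]
    simp only [hw, Real.one_rpow, ENNReal.ofReal_one, lintegral_const, measure_univ, mul_one]
    rw [ENNReal.one_le_ofReal, one_le_div (by linarith)]
    push_cast
    linarith
  | succ k ih =>
    obtain ⟨C₁, hC₁, h₁⟩ := ih (by omega)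
    obtain ⟨C₂, hC₂, h₂⟩ :=
      exists_lintegral_norm_orthogonalProjectionOnto_rpow_neg_le d (d - k) (by omega)
    refine ⟨C₁ * C₂, mul_pos hC₁ hC₂, fun s hs₀ hs => ?_⟩
    have hcast : ((d - k : ℕ) : ℝ) = d - k := Nat.cast_sub (by omega)
    push_cast at hs ⊢
    have hs' : s < (d : ℝ) - k := by linarith
    have hmp := (measurePreserving_piFinSuccAbove
      (fun _ : Fin (k + 1) => _root_.stdGaussian d) 0).symm
    rw [← hmp.lintegral_comp_emb (MeasurableEquiv.measurableEmbedding _), lintegral_prod_symm]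
    swap
    · exact ((((measurable_wedgeNorm d (k + 1)).comp
        (MeasurableEquiv.measurable _)).pow_const _).ennreal_ofReal).aemeasurable
    have hinner : ∀ w : Fin k → Fin d → ℝ,
        ∫⁻ v, ENNReal.ofReal (wedgeNorm ((MeasurableEquiv.piFinSuccAbove
            (fun _ : Fin (k + 1) => Fin d → ℝ) 0).symm (v, w)) ^ (-s)) ∂_root_.stdGaussian d
          ≤ ENNReal.ofReal (C₂ / (d - k - s)) * ENNReal.ofReal (wedgeNorm w ^ (-s)) := by
      intro w
      set V := Submodule.span ℝ (Set.range fun a => WithLp.toLp 2 (w a))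
      have hV : d - k ≤ Module.finrank ℝ Vᗮ := by
        have h := V.finrank_add_finrank_orthogonal
        have h' : Module.finrank ℝ V ≤ k := by
          simpa [Set.finrank] using finrank_range_le_card (R := ℝ) fun a => WithLp.toLp 2 (w a)
        rw [finrank_euclideanSpace_fin] at h
        omega
      calc _ = ∫⁻ v, ENNReal.ofReal (‖Vᗮ.orthogonalProjectionOnto (WithLp.toLp 2 v)‖ ^ (-s))
                * ENNReal.ofReal (wedgeNorm w ^ (-s)) ∂_root_.stdGaussian d := by
            refine lintegral_congr fun v => ?_
            have : (MeasurableEquiv.piFinSuccAbove (fun _ : Fin (k + 1) => Fin d → ℝ) 0).symm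
                (v, w) = Fin.cons v w := by
              ext a
              simp [MeasurableEquiv.piFinSuccAbove]
            rw [this, wedgeNorm_fin_cons, Real.mul_rpow (norm_nonneg _) (wedgeNorm_nonneg _),
              ENNReal.ofReal_mul (by positivity)]
        _ = (∫⁻ v, ENNReal.ofReal (‖Vᗮ.orthogonalProjectionOnto (WithLp.toLp 2 v)‖ ^ (-s))
                ∂_root_.stdGaussian d) * ENNReal.ofReal (wedgeNorm w ^ (-s)) := by
            rw [lintegral_mul_const]
            fun_prop
        _ ≤ _ := by
            gcongr
            have h := h₂ Vᗮ hV s hs₀ (by rw [hcast]; exact hs')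
            rwa [← map_pi_eq_stdGaussian, lintegral_map (by fun_prop) (by fun_prop), hcast] at h
    calc _ ≤ ∫⁻ w : Fin k → Fin d → ℝ, ENNReal.ofReal (C₂ / (d - k - s))
              * ENNReal.ofReal (wedgeNorm w ^ (-s))
              ∂(Measure.pi fun _ => _root_.stdGaussian d) := lintegral_mono hinner
      _ = ENNReal.ofReal (C₂ / (d - k - s)) * ∫⁻ w : Fin k → Fin d → ℝ,
            ENNReal.ofReal (wedgeNorm w ^ (-s))
              ∂(Measure.pi fun _ => _root_.stdGaussian d) :=
          lintegral_const_mul _ ((measurable_wedgeNorm d k).pow_const _).ennreal_ofReal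
      _ ≤ ENNReal.ofReal (C₂ / (d - k - s)) * ENNReal.ofReal C₁ := by
          gcongr
          refine (h₁ s hs₀ (by linarith)).trans (ENNReal.ofReal_le_ofReal ?_)
          exact div_le_self hC₁.le (by linarith)
      _ = _ := by
          have : 0 < (d : ℝ) - k - s := by linarith
          rw [← ENNReal.ofReal_mul (by positivity)]
          congr 1
          rw [show (d : ℝ) - (k + 1) + 1 - s = d - k - s by ring]
          ring

theorem Real.rpow_neg_le_exp_one_mul_rpow_neg_sub {t κ p : ℝ} (hκ : 0 < κ)
    (ht : Real.exp (-κ) < t) : t ^ (-p) ≤ Real.exp 1 * t ^ (-(p - 1 / κ)) := by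
  have ht₀ : 0 < t := (Real.exp_pos _).trans ht
  have hone : 1 ≤ Real.exp 1 * t ^ (1 / κ) := by
    have h : Real.exp (-1) ≤ t ^ (1 / κ) := by
      calc Real.exp (-1) = Real.exp (-κ) ^ (1 / κ) := by
            rw [← Real.exp_mul]
            congr 1
            field_simp
        _ ≤ t ^ (1 / κ) := by gcongr
    calc (1 : ℝ) = Real.exp 1 * Real.exp (-1) := by rw [← Real.exp_add]; simp
      _ ≤ _ := by gcongr
  calc t ^ (-p) ≤ t ^ (-p) * (Real.exp 1 * t ^ (1 / κ)) :=
        le_mul_of_one_le_right (by positivity) hone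
    _ = Real.exp 1 * (t ^ (-p) * t ^ (1 / κ)) := by ring
    _ = _ := by
        rw [← Real.rpow_add ht₀]
        ring_nf

/-- For independent standard Gaussians `x₁,…,x_i` in `ℝ^d` (`1 ≤ i ≤ d`), there is a
constant `C` depending only on `d` and `i` such that for all `κ ≥ 1`,
`E(‖x₁∧⋯∧x_i‖^{-(d-i+1)} · 𝟙(‖x₁∧⋯∧x_i‖ > e^{-κ})) ≤ C·κ`. -/
theorem expectation_wedgeNorm_truncated_le
    (d i : ℕ) (hi : 1 ≤ i) (hid : i ≤ d) :
    ∃ C : ℝ, 0 < C ∧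
      ∀ κ : ℝ, 1 ≤ κ →
        ∫⁻ x in {x : Fin i → (Fin d → ℝ) | Real.exp (-κ) < wedgeNorm x},
            ENNReal.ofReal (wedgeNorm x ^ (-((d : ℝ) - i + 1)))
            ∂(Measure.pi fun _ : Fin i => stdGaussian d)
          ≤ ENNReal.ofReal (C * κ) := by
  obtain ⟨C, hC, h⟩ := exists_lintegral_wedgeNorm_rpow_neg_le d i hid
  refine ⟨Real.exp 1 * C, by positivity, fun κ hκ => ?_⟩
  have hκ₀ : 0 < κ := by linarith
  have hκ' : 1 / κ ≤ 1 := by rwa [div_le_one hκ₀]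
  have hκpos : 0 < 1 / κ := by positivity
  have hid' : (i : ℝ) ≤ d := by exact_mod_cast hid
  calc _ ≤ ∫⁻ x in {x : Fin i → (Fin d → ℝ) | Real.exp (-κ) < wedgeNorm x},
            ENNReal.ofReal (Real.exp 1)
              * ENNReal.ofReal (wedgeNorm x ^ (-((d : ℝ) - i + 1 - 1 / κ)))
            ∂(Measure.pi fun _ : Fin i => _root_.stdGaussian d) := by
        refine setLIntegral_mono (((measurable_wedgeNorm d i).pow_const _).ennreal_ofReal.const_mul
          _) fun x hx => ?_
        rw [← ENNReal.ofReal_mul (Real.exp_nonneg 1)]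
        exact ENNReal.ofReal_le_ofReal (Real.rpow_neg_le_exp_one_mul_rpow_neg_sub hκ₀ hx)
    _ ≤ ∫⁻ x : Fin i → (Fin d → ℝ), ENNReal.ofReal (Real.exp 1)
              * ENNReal.ofReal (wedgeNorm x ^ (-((d : ℝ) - i + 1 - 1 / κ)))
            ∂(Measure.pi fun _ : Fin i => _root_.stdGaussian d) := setLIntegral_le_lintegral _ _
    _ = ENNReal.ofReal (Real.exp 1) * ∫⁻ x : Fin i → (Fin d → ℝ),
          ENNReal.ofReal (wedgeNorm x ^ (-((d : ℝ) - i + 1 - 1 / κ)))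
            ∂(Measure.pi fun _ : Fin i => _root_.stdGaussian d) :=
        lintegral_const_mul _ ((measurable_wedgeNorm d i).pow_const _).ennreal_ofReal
    _ ≤ ENNReal.ofReal (Real.exp 1)
          * ENNReal.ofReal (C / ((d : ℝ) - i + 1 - ((d : ℝ) - i + 1 - 1 / κ))) := by
        gcongr
        exact h _ (by linarith) (by linarith)
    _ = _ := by
        rw [← ENNReal.ofReal_mul (Real.exp_nonneg 1), sub_sub_cancel, mul_assoc]
        simp
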